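/- Let 0 < x < 1/2, r = x/(1-x), and K >= 2. Then the magnetization (sum_{i=0}^{K} i * r^i)/(K * sum_{i=0}^{K} r^i) of the geometric distribution with ratio r is strictly less than x. -/

import Mathlib

theorem geometric_magnetization_lt_x (x r : ℝ)
    (hx : 0 < x) (hx1 : x < 1 / 2) (hr : r = x / (1 - x))
    (K : ℕ) (hK : 2 ≤ K) :
    (∑ i ∈ Finset.range (K + 1), (i : ℝ) * r ^ i) /
        ((K : ℝ) * ∑ i ∈ Finset.range (K + 1), r ^ i) < x := by
  have h1x : 0 < 1 - x := by linarith
  have hr0 : 0 < r := by rw [hr]; positivity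
  have hr1 : r < 1 := by rw [hr, div_lt_one h1x]; linarith
  have hxr : x * (1 + r) = r := by rw [hr]; field_simp; ring
  have hS : ∀ n : ℕ, ((n : ℝ) + 1) * r ^ n ≤ ∑ i ∈ Finset.range (n + 1), r ^ i := by
    intro n
    have h := Finset.card_nsmul_le_sum (Finset.range (n + 1)) (fun i => r ^ i) (r ^ n) (by
      intro i hi
      exact pow_le_pow_of_le_one hr0.le hr1.le (by have := Finset.mem_range.mp hi; omega))
    simpa [nsmul_eq_mul] using h
  have key : (1 + r) * (∑ i ∈ Finset.range (K + 1), (i : ℝ) * r ^ i) <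
      r * ((K : ℝ) * ∑ i ∈ Finset.range (K + 1), r ^ i) := by
    induction K, hK using Nat.le_induction with
    | base =>
      norm_num [Finset.sum_range_succ]
      nlinarith [mul_pos hr0 (sub_pos.mpr hr1)]
    | succ n hn ih =>
      rw [Finset.sum_range_succ _ (n + 1), Finset.sum_range_succ _ (n + 1)]
      have h := mul_le_mul_of_nonneg_left (hS n) hr0.le
      push_cast
      rw [pow_succ]
      nlinarith
  have hpos : 0 < (K : ℝ) * ∑ i ∈ Finset.range (K + 1), r ^ i := by
    have : 0 < ∑ i ∈ Finset.range (K + 1), r ^ i :=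
      Finset.sum_pos (fun i _ => pow_pos hr0 i) (by simp)
    have : (0 : ℝ) < K := by exact_mod_cast (by omega : 0 < K)
    positivity
  rw [div_lt_iff₀ hpos]
  have h2 : (0 : ℝ) < 1 + r := by linarith
  refine lt_of_mul_lt_mul_left ?_ h2.le
  rw [← mul_assoc, mul_comm (1 + r) x, hxr]
  exact key
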